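/- arXiv:2508.21506 — 10 statements merged into one kernel-verified Lean document; each statement's English description precedes it below -/
import Mathlib

section
/- Let a, t ∈ ℝ with 1 − t·a·α ≠ 0, where α = wᵀS⁻¹w. Then the matrix S − t·a·w·wᵀ is invertible, and trace((S − t·a·w·wᵀ)⁻¹·D) = trace(S⁻¹·D) + (t·a/(1 − t·a·α))·β, where β = wᵀS⁻¹DS⁻¹w. (This is the explicit formula for Kemeny's constant of the perturbed graph: κ(P_pq(t)) = κ(P) + t·a_pq·β(p,q)/(1 − t·a_pq·α(p,q)).) -/
open Matrix BigOperators

/-- Conjugating a matrix by a rank-one matrix `u vᵀ` scales the rank-one matrix. -/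
theorem vecMulVec_mul_mul_vecMulVec {m R : Type*} [Fintype m] [CommRing R]
    (u v : m → R) (B : Matrix m m R) :
    vecMulVec u v * B * vecMulVec u v = (v ⬝ᵥ B *ᵥ u) • vecMulVec u v := by
  rw [vecMulVec_mul, vecMulVec_mul_vecMulVec, dotProduct_mulVec, vecMulVec_smul]

/-- The Sherman–Morrison formula, as a right inverse. -/
theorem sub_smul_vecMulVec_mul_eq_one {m K : Type*} [Fintype m] [DecidableEq m] [Field K]
    (u v : m → K) (M : Matrix m m K) (hM : IsUnit M.det) (s : K)
    (h : 1 - s * (v ⬝ᵥ M⁻¹ *ᵥ u) ≠ 0) :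
    (M - s • vecMulVec u v) *
      (M⁻¹ + (s / (1 - s * (v ⬝ᵥ M⁻¹ *ᵥ u))) • (M⁻¹ * vecMulVec u v * M⁻¹)) = 1 := by
  have hV := vecMulVec_mul_mul_vecMulVec u v M⁻¹
  set x := v ⬝ᵥ M⁻¹ *ᵥ u
  set V := vecMulVec u v
  have hMM : M * M⁻¹ = 1 := mul_nonsing_inv M hM
  have h₁ : M * (M⁻¹ * V * M⁻¹) = V * M⁻¹ := by
    rw [← mul_assoc, ← mul_assoc, hMM, one_mul]
  have h₂ : V * (M⁻¹ * V * M⁻¹) = x • (V * M⁻¹) := by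
    rw [← mul_assoc, ← mul_assoc, hV, smul_mul]
  have hc : s / (1 - s * x) - s - s * (s / (1 - s * x)) * x = 0 := by
    field_simp
    ring
  calc _ = 1 + (s / (1 - s * x) - s - s * (s / (1 - s * x)) * x) • (V * M⁻¹) := by
        rw [sub_mul, mul_add, mul_add, Matrix.mul_smul, Matrix.smul_mul, Matrix.smul_mul,
          Matrix.mul_smul, h₁, h₂, hMM]
        module
    _ = 1 := by rw [hc, zero_smul, add_zero]

/-- The trace of `B u vᵀ C` as a bilinear form. -/
theorem trace_mul_vecMulVec_mul {m R : Type*} [Fintype m] [CommRing R]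
    (u v : m → R) (B C : Matrix m m R) :
    (B * vecMulVec u v * C).trace = v ⬝ᵥ (C * B) *ᵥ u := by
  rw [trace_mul_comm, ← mul_assoc, mul_vecMulVec, trace_vecMulVec, dotProduct_comm]

/-- Explicit formula for Kemeny's constant of the perturbed graph:
`κ(P_pq(t)) = κ(P) + t·a_pq·β(p,q)/(1 − t·a_pq·α(p,q))`. -/
theorem stmt_0 {n : ℕ} (hn : 2 ≤ n)
    (A : Matrix (Fin n) (Fin n) ℝ) (hA : A.IsSymm) (hAnn : ∀ i j, 0 ≤ A i j)
    (d : Fin n → ℝ) (hd : d = A.mulVec (fun _ => 1)) (hdpos : ∀ i, 0 < d i)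
    (D L S : Matrix (Fin n) (Fin n) ℝ)
    (hD : D = Matrix.diagonal d) (hL : L = D - A)
    (hS : S = L + (1 / (∑ i, d i)) • Matrix.vecMulVec d d)
    (p q : Fin n) (hpq : p ≠ q)
    (w : Fin n → ℝ) (hw : w = Pi.single p 1 - Pi.single q 1)
    (hSinv : IsUnit S.det)
    (a t : ℝ)
    (α β : ℝ) (hα : α = w ⬝ᵥ S⁻¹.mulVec w)
    (hβ : β = w ⬝ᵥ (S⁻¹ * D * S⁻¹).mulVec w)
    (h : 1 - t * a * α ≠ 0) :
    IsUnit (S - (t * a) • Matrix.vecMulVec w w).det ∧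
      ((S - (t * a) • Matrix.vecMulVec w w)⁻¹ * D).trace
        = (S⁻¹ * D).trace + (t * a / (1 - t * a * α)) * β := by
  subst hα hβ
  have hinv := sub_smul_vecMulVec_mul_eq_one w w S hSinv (t * a) h
  refine ⟨isUnit_det_of_right_inverse hinv, ?_⟩
  rw [inv_eq_right_inv hinv, add_mul, trace_add, smul_mul, trace_smul, smul_eq_mul,
    mul_assoc (S⁻¹ * vecMulVec w w), trace_mul_vecMulVec_mul]
end

section
/- Assume p ≠ q. Then β = wᵀS⁻¹DS⁻¹w > 0. (Hence the weighted directional derivative μ(p,q) = a_pq·β(p,q) of Kemeny's constant is positive for every edge with a_pq > 0, including cut-edges, and the unweighted measure μ̄(p,q) = β(p,q) is positive also for non-edges.) -/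
open Matrix BigOperators

/-- Positivity of `β(p,q) = wᵀS⁻¹DS⁻¹w`: the weighted directional derivative
`μ(p,q) = a_pq·β(p,q)` of Kemeny's constant is positive for every edge (including
cut-edges), and the unweighted measure `μ̄(p,q) = β(p,q)` is positive also for non-edges. -/
theorem stmt_2 {n : ℕ} (hn : 2 ≤ n)
    (A : Matrix (Fin n) (Fin n) ℝ) (hA : A.IsSymm) (hAnn : ∀ i j, 0 ≤ A i j)
    (d : Fin n → ℝ) (hd : d = A.mulVec (fun _ => 1)) (hdpos : ∀ i, 0 < d i)
    (D L S : Matrix (Fin n) (Fin n) ℝ)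
    (hD : D = Matrix.diagonal d) (hL : L = D - A)
    (hS : S = L + (1 / (∑ i, d i)) • Matrix.vecMulVec d d)
    (p q : Fin n) (hpq : p ≠ q)
    (w : Fin n → ℝ) (hw : w = Pi.single p 1 - Pi.single q 1)
    (hSinv : IsUnit S.det) :
    0 < w ⬝ᵥ (S⁻¹ * D * S⁻¹).mulVec w := by
  have hSsymm : Sᵀ = S := by
    rw [hS, hL, hD, transpose_add, transpose_sub, transpose_smul, diagonal_transpose, hA.eq,
      transpose_vecMulVec]
  have hD_pos : D.PosDef := hD ▸ PosDef.diagonal hdpos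
  have hw_ne : w ≠ 0 := fun h => by
    have h_p := congrFun h p
    simp [hw, hpq] at h_p
  have hx_ne : S⁻¹ *ᵥ w ≠ 0 := fun h => hw_ne <| by
    rw [← one_mulVec w, ← mul_nonsing_inv S hSinv, ← mulVec_mulVec, h, mulVec_zero]
  have hx : w ᵥ* S⁻¹ = S⁻¹ *ᵥ w := by
    rw [← mulVec_transpose, transpose_nonsing_inv, hSsymm]
  rw [← mulVec_mulVec, ← mulVec_mulVec, dotProduct_mulVec, hx]
  simpa using hD_pos.dotProduct_mulVec_pos hx_ne
end

section
/- Assume that the kernel of L = D − A is spanned by the all-ones vector 𝟙, i.e., every x ∈ ℝⁿ with L·x = 0 is a scalar multiple of 𝟙 (this encodes connectedness of the weighted graph). Then the matrix S = L + (1/(𝟙ᵀd))·d·dᵀ is symmetric positive definite; in particular S is invertible. -/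
open Matrix BigOperators

namespace Matrix

variable {ι : Type*} [Fintype ι] [DecidableEq ι]

/-- The weighted graph Laplacian acts by weighted differences along edges. -/
lemma diagonal_degree_sub_mulVec_apply (A : Matrix ι ι ℝ) (x : ι → ℝ) (i : ι) :
    ((diagonal (A *ᵥ fun _ => 1) - A) *ᵥ x) i = ∑ j, A i j * (x i - x j) := by
  rw [sub_mulVec, Pi.sub_apply, mulVec_diagonal]
  simp only [mulVec, dotProduct, mul_one, mul_sub, Finset.sum_sub_distrib, Finset.sum_mul]

/-- The quadratic form of a weighted graph Laplacian is a sum of squares over the edges. -/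
lemma two_mul_dotProduct_diagonal_degree_sub_mulVec {A : Matrix ι ι ℝ} (hA : A.IsSymm)
    (x : ι → ℝ) :
    2 * (x ⬝ᵥ (diagonal (A *ᵥ fun _ => 1) - A) *ᵥ x) =
      ∑ i, ∑ j, A i j * (x i - x j) ^ 2 := by
  have h₁ : x ⬝ᵥ (diagonal (A *ᵥ fun _ => 1) - A) *ᵥ x =
      ∑ i, ∑ j, x i * (A i j * (x i - x j)) := by
    simp only [dotProduct, diagonal_degree_sub_mulVec_apply, Finset.mul_sum]
  have h₂ : x ⬝ᵥ (diagonal (A *ᵥ fun _ => 1) - A) *ᵥ x =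
      ∑ i, ∑ j, x j * (A i j * (x j - x i)) := by
    rw [h₁, Finset.sum_comm]
    simp only [hA.apply]
  rw [two_mul]
  nth_rewrite 1 [h₁]
  rw [h₂]
  simp only [← Finset.sum_add_distrib]
  refine Finset.sum_congr rfl fun i _ => Finset.sum_congr rfl fun j _ => ?_
  ring

lemma dotProduct_diagonal_degree_sub_mulVec_nonneg {A : Matrix ι ι ℝ} (hA : A.IsSymm)
    (hA₀ : ∀ i j, 0 ≤ A i j) (x : ι → ℝ) :
    0 ≤ x ⬝ᵥ (diagonal (A *ᵥ fun _ => 1) - A) *ᵥ x := by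
  have h : 0 ≤ ∑ i, ∑ j, A i j * (x i - x j) ^ 2 :=
    Finset.sum_nonneg fun i _ => Finset.sum_nonneg fun j _ => mul_nonneg (hA₀ i j) (sq_nonneg _)
  linarith [two_mul_dotProduct_diagonal_degree_sub_mulVec hA x]

lemma diagonal_degree_sub_mulVec_eq_zero {A : Matrix ι ι ℝ} (hA : A.IsSymm)
    (hA₀ : ∀ i j, 0 ≤ A i j) {x : ι → ℝ}
    (hx : x ⬝ᵥ (diagonal (A *ᵥ fun _ => 1) - A) *ᵥ x = 0) :
    (diagonal (A *ᵥ fun _ => 1) - A) *ᵥ x = 0 := by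
  have h := two_mul_dotProduct_diagonal_degree_sub_mulVec hA x
  rw [hx, mul_zero] at h
  have hterm (i j : ι) : 0 ≤ A i j * (x i - x j) ^ 2 := mul_nonneg (hA₀ i j) (sq_nonneg _)
  ext i
  rw [diagonal_degree_sub_mulVec_apply]
  refine Finset.sum_eq_zero fun j _ => ?_
  have hi := (Finset.sum_eq_zero_iff_of_nonneg
    fun i _ => Finset.sum_nonneg fun j _ => hterm i j).1 h.symm i (Finset.mem_univ i)
  have hij := (Finset.sum_eq_zero_iff_of_nonneg fun j _ => hterm i j).1 hi j (Finset.mem_univ j)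
  simpa using hij

end Matrix

/-- If the kernel of the graph Laplacian `L = D − A` is spanned by the all-ones vector
(connectedness), then `S = L + (1/(𝟙ᵀd))·d·dᵀ` is symmetric positive definite;
in particular `S` is invertible. -/
theorem stmt_3 {n : ℕ} (hn : 2 ≤ n)
    (A : Matrix (Fin n) (Fin n) ℝ) (hA : A.IsSymm) (hAnn : ∀ i j, 0 ≤ A i j)
    (d : Fin n → ℝ) (hd : d = A.mulVec (fun _ => 1)) (hdpos : ∀ i, 0 < d i)
    (D L S : Matrix (Fin n) (Fin n) ℝ)
    (hD : D = Matrix.diagonal d) (hL : L = D - A)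
    (hS : S = L + (1 / (∑ i, d i)) • Matrix.vecMulVec d d)
    (hker : ∀ x : Fin n → ℝ, L.mulVec x = 0 → ∃ c : ℝ, x = fun _ => c) :
    S.PosDef ∧ IsUnit S.det := by
  have hpos : 0 < ∑ i, d i :=
    Finset.sum_pos (fun i _ => hdpos i) ⟨⟨0, by omega⟩, Finset.mem_univ _⟩
  have hL' : L = diagonal (A *ᵥ fun _ => 1) - A := by rw [hL, hD, hd]
  have hform (x : Fin n → ℝ) :
      x ⬝ᵥ S *ᵥ x = x ⬝ᵥ L *ᵥ x + (1 / ∑ i, d i) * (d ⬝ᵥ x) ^ 2 := by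
    rw [hS, add_mulVec, dotProduct_add, smul_mulVec, dotProduct_smul, vecMulVec_mulVec,
      op_smul_eq_smul, dotProduct_smul, dotProduct_comm x d, smul_eq_mul, smul_eq_mul, sq]
  have hSsymm : S.IsSymm := by
    rw [hS, hL, hD]
    exact ((isSymm_diagonal d).sub hA).add
      (IsSymm.smul (by rw [IsSymm, transpose_vecMulVec]) _)
  have hSpos : S.PosDef := by
    refine posDef_iff_dotProduct_mulVec.2 ⟨by simpa [IsHermitian] using hSsymm.eq, fun x hx => ?_⟩
    rw [star_trivial, hform]
    have hLx : 0 ≤ x ⬝ᵥ L *ᵥ x := hL' ▸ dotProduct_diagonal_degree_sub_mulVec_nonneg hA hAnn x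
    have hdx : 0 ≤ (1 / ∑ i, d i) * (d ⬝ᵥ x) ^ 2 := by positivity
    refine (add_nonneg hLx hdx).lt_of_ne' fun h => hx ?_
    obtain ⟨h₁, h₂⟩ := (add_eq_zero_iff_of_nonneg hLx hdx).1 h
    rw [hL'] at h₁
    obtain ⟨c, rfl⟩ := hker x (hL' ▸ diagonal_degree_sub_mulVec_eq_zero hA hAnn h₁)
    have hc : (∑ i, d i) * c = 0 := by
      simpa [hpos.ne', dotProduct, ← Finset.sum_mul] using h₂
    funext i
    exact (mul_eq_zero.1 hc).resolve_left hpos.ne'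
  exact ⟨hSpos, (isUnit_iff_isUnit_det S).1 hSpos.isUnit⟩
end

section
/- Let a ∈ ℝ and assume S_pq := S − a·w·wᵀ is also invertible. Then 1 − a·α ≠ 0, where α = wᵀS⁻¹w, and a·wᵀS⁻¹·D·S_pq⁻¹·w = a·β/(1 − a·α), where β = wᵀS⁻¹DS⁻¹w. (This relates the edge-removal centrality c(p,q) of Altafini et al. to the derivative measure: c(p,q) = μ(p,q)/(1 − a_pq·wᵀS⁻¹w) whenever {p,q} is not a cut-edge.) -/
open Matrix BigOperators

/-- Sherman–Morrison for a symmetric rank-one downdate, applied to the updating vector. -/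
theorem inv_mulVec_eq_smul_inv_sub_vecMulVec_mulVec {ι K : Type*} [Fintype ι] [DecidableEq ι]
    [Field K] {S : Matrix ι ι K} {w : ι → K} {a : K} (hS : IsUnit S.det)
    (hT : IsUnit (S - a • vecMulVec w w).det) :
    S⁻¹ *ᵥ w = (1 - a * (w ⬝ᵥ S⁻¹ *ᵥ w)) • (S - a • vecMulVec w w)⁻¹ *ᵥ w := by
  have key : (S - a • vecMulVec w w) *ᵥ (S⁻¹ *ᵥ w) = (1 - a * (w ⬝ᵥ S⁻¹ *ᵥ w)) • w := by
    rw [sub_mulVec, mulVec_mulVec, mul_nonsing_inv _ hS, one_mulVec, smul_mulVec,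
      vecMulVec_mulVec, op_smul_eq_smul, smul_smul, sub_smul, one_smul]
  rw [← mulVec_smul, ← key, mulVec_mulVec, nonsing_inv_mul _ hT, one_mulVec]

/-- Relation between the edge-removal centrality `c(p,q)` of Altafini et al. and the
derivative measure: `c(p,q) = μ(p,q)/(1 − a_pq·wᵀS⁻¹w)` when `{p,q}` is not a cut-edge. -/
theorem stmt_4 {n : ℕ} (hn : 2 ≤ n)
    (A : Matrix (Fin n) (Fin n) ℝ) (hA : A.IsSymm) (hAnn : ∀ i j, 0 ≤ A i j)
    (d : Fin n → ℝ) (hd : d = A.mulVec (fun _ => 1)) (hdpos : ∀ i, 0 < d i)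
    (D L S : Matrix (Fin n) (Fin n) ℝ)
    (hD : D = Matrix.diagonal d) (hL : L = D - A)
    (hS : S = L + (1 / (∑ i, d i)) • Matrix.vecMulVec d d)
    (p q : Fin n) (hpq : p ≠ q)
    (w : Fin n → ℝ) (hw : w = Pi.single p 1 - Pi.single q 1)
    (hSinv : IsUnit S.det)
    (a : ℝ) (hSpq : IsUnit (S - a • Matrix.vecMulVec w w).det)
    (α β : ℝ) (hα : α = w ⬝ᵥ S⁻¹.mulVec w)
    (hβ : β = w ⬝ᵥ (S⁻¹ * D * S⁻¹).mulVec w) :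
    1 - a * α ≠ 0 ∧
      a * (w ⬝ᵥ (S⁻¹ * D * (S - a • Matrix.vecMulVec w w)⁻¹).mulVec w)
        = a * β / (1 - a * α) := by
  have h := inv_mulVec_eq_smul_inv_sub_vecMulVec_mulVec hSinv hSpq
  rw [← hα] at h
  have hne : 1 - a * α ≠ 0 := by
    intro h0
    rw [h0, zero_smul] at h
    rw [h, dotProduct_zero] at hα
    simp [hα] at h0
  refine ⟨hne, ?_⟩
  rw [eq_div_iff hne, hβ, ← mulVec_mulVec _ (S⁻¹ * D) S⁻¹, h, ← mulVec_mulVec,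
    mulVec_smul, dotProduct_smul, smul_eq_mul]
  ring
end

section
/- Assume p ≠ q, let H = D^{−1/2}·S·D^{−1/2} (a symmetric matrix), and let η₁,…,η_n denote the eigenvalues of H. Then 2·(min_i 1/d_i)·(min_i η_i⁻²) ≤ wᵀS⁻¹DS⁻¹w ≤ 2·(max_i 1/d_i)·(max_i η_i⁻²), where d_i are the entries of the degree vector d. (The eigenvalues of H are 1−λ_i for the eigenvalues λ₁ ≤ … ≤ λ_{n−1} of the transition matrix P = D⁻¹A together with 1, so this is the bound 2·min_i(d_i⁻¹)·min{1/(1−λ₁)², 1} ≤ μ̄(p,q) ≤ 2·max_i(d_i⁻¹)·max{1/(1−λ_{n−1})², 1}.) -/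
open Matrix BigOperators

/-- Parseval's identity for the eigenvector basis of a real symmetric matrix. -/
theorem Matrix.IsHermitian.sum_sq_dotProduct_eigenvectorBasis {ι : Type*} [Fintype ι]
    [DecidableEq ι] {H : Matrix ι ι ℝ} (hH : H.IsHermitian) (x : ι → ℝ) :
    ∑ i, (⇑(hH.eigenvectorBasis i) ⬝ᵥ x) ^ 2 = x ⬝ᵥ x := by
  have h := hH.eigenvectorBasis.sum_sq_norm_inner_right (WithLp.toLp 2 x)
  rw [EuclideanSpace.real_norm_sq_eq] at h
  simp only [EuclideanSpace.inner_eq_star_dotProduct, Real.norm_eq_abs, sq_abs] at h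
  simpa [dotProduct, ← pow_two, mul_comm] using h

theorem Matrix.IsHermitian.dotProduct_eigenvectorBasis_mulVec {ι : Type*} [Fintype ι]
    [DecidableEq ι] {H : Matrix ι ι ℝ} (hH : H.IsHermitian) (x : ι → ℝ) (i : ι) :
    ⇑(hH.eigenvectorBasis i) ⬝ᵥ H *ᵥ x
      = hH.eigenvalues i * (⇑(hH.eigenvectorBasis i) ⬝ᵥ x) := by
  have hT : Hᵀ = H := by simpa using hH.eq
  rw [dotProduct_mulVec, ← mulVec_transpose, hT, hH.mulVec_eigenvectorBasis, smul_dotProduct,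
    smul_eq_mul]

/-- The squared length of `x` lies between the extreme values of `η⁻²` times that of `H x`,
where `η` runs over the eigenvalues of the invertible symmetric matrix `H`. -/
theorem Matrix.IsHermitian.dotProduct_self_bounds {ι : Type*} [Fintype ι]
    [DecidableEq ι] {H : Matrix ι ι ℝ} (hH : H.IsHermitian) (hdet : H.det ≠ 0) (x : ι → ℝ) :
    (⨅ i, (hH.eigenvalues i)⁻¹ ^ 2) * (H *ᵥ x ⬝ᵥ H *ᵥ x) ≤ x ⬝ᵥ x ∧
      x ⬝ᵥ x ≤ (⨆ i, (hH.eigenvalues i)⁻¹ ^ 2) * (H *ᵥ x ⬝ᵥ H *ᵥ x) := by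
  have hne : ∀ i, hH.eigenvalues i ≠ 0 := fun i h0 => hdet <| by
    rw [hH.det_eq_prod_eigenvalues]
    exact Finset.prod_eq_zero (Finset.mem_univ i) (by simp [h0])
  have hcoord : ∀ i, (⇑(hH.eigenvectorBasis i) ⬝ᵥ x) ^ 2
      = (hH.eigenvalues i)⁻¹ ^ 2 * (⇑(hH.eigenvectorBasis i) ⬝ᵥ H *ᵥ x) ^ 2 := fun i => by
    rw [hH.dotProduct_eigenvectorBasis_mulVec]
    field_simp [hne i]
  rw [← hH.sum_sq_dotProduct_eigenvectorBasis x,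
    ← hH.sum_sq_dotProduct_eigenvectorBasis (H *ᵥ x), Finset.mul_sum, Finset.mul_sum]
  refine ⟨Finset.sum_le_sum fun i _ => ?_, Finset.sum_le_sum fun i _ => ?_⟩ <;> rw [hcoord i]
  · exact mul_le_mul_of_nonneg_right (ciInf_le (Set.finite_range _).bddBelow i) (sq_nonneg _)
  · exact mul_le_mul_of_nonneg_right
      (le_ciSup (f := fun j => (hH.eigenvalues j)⁻¹ ^ 2) (Set.finite_range _).bddAbove i)
      (sq_nonneg _)

/-- Bound `2·(min_i d_i⁻¹)·(min_i η_i⁻²) ≤ wᵀS⁻¹DS⁻¹w ≤ 2·(max_i d_i⁻¹)·(max_i η_i⁻²)`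
where `η_i` are the eigenvalues of the symmetric matrix `H = D^{−1/2}·S·D^{−1/2}`. -/
theorem stmt_9 {n : ℕ} (hn : 2 ≤ n)
    (A : Matrix (Fin n) (Fin n) ℝ) (hA : A.IsSymm) (hAnn : ∀ i j, 0 ≤ A i j)
    (d : Fin n → ℝ) (hd : d = A.mulVec (fun _ => 1)) (hdpos : ∀ i, 0 < d i)
    (D L S : Matrix (Fin n) (Fin n) ℝ)
    (hD : D = Matrix.diagonal d) (hL : L = D - A)
    (hS : S = L + (1 / (∑ i, d i)) • Matrix.vecMulVec d d)
    (p q : Fin n) (hpq : p ≠ q)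
    (w : Fin n → ℝ) (hw : w = Pi.single p 1 - Pi.single q 1)
    (hSinv : IsUnit S.det)
    (Dneghalf H : Matrix (Fin n) (Fin n) ℝ)
    (hDnh : Dneghalf = Matrix.diagonal (fun i => (Real.sqrt (d i))⁻¹))
    (hH : H = Dneghalf * S * Dneghalf)
    (hHh : H.IsHermitian) :
    2 * (⨅ i, (d i)⁻¹) * (⨅ i, ((hHh.eigenvalues i)⁻¹) ^ 2)
        ≤ w ⬝ᵥ (S⁻¹ * D * S⁻¹).mulVec w ∧
      w ⬝ᵥ (S⁻¹ * D * S⁻¹).mulVec w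
        ≤ 2 * (⨆ i, (d i)⁻¹) * (⨆ i, ((hHh.eigenvalues i)⁻¹) ^ 2) := by
  have hsq : ∀ i, √(d i) ≠ 0 := fun i => (Real.sqrt_pos.2 (hdpos i)).ne'
  have hST : Sᵀ = S := by
    rw [hS, hL, hD]
    simp [transpose_vecMulVec, hA.eq]
  have hSiT : (S⁻¹)ᵀ = S⁻¹ := by rw [transpose_nonsing_inv, hST]
  set y := S⁻¹ *ᵥ w with hy
  set x : Fin n → ℝ := fun i => √(d i) * y i with hx
  have hform : w ⬝ᵥ (S⁻¹ * D * S⁻¹) *ᵥ w = x ⬝ᵥ x := by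
    rw [← mulVec_mulVec, ← mulVec_mulVec, dotProduct_mulVec, ← mulVec_transpose, hSiT, ← hy, hD]
    simp only [dotProduct, mulVec_diagonal, hx]
    refine Finset.sum_congr rfl fun i _ => ?_
    linear_combination (-(y i) ^ 2) * Real.mul_self_sqrt (hdpos i).le
  have hxy : Dneghalf *ᵥ x = y := by
    ext i
    rw [hDnh, mulVec_diagonal, hx]
    exact inv_mul_cancel_left₀ (hsq i) (y i)
  have hSy : S *ᵥ y = w := by
    rw [hy, mulVec_mulVec, mul_nonsing_inv _ hSinv, one_mulVec]
  have hHx : H *ᵥ x ⬝ᵥ H *ᵥ x = (d p)⁻¹ + (d q)⁻¹ := by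
    rw [hH, ← mulVec_mulVec, ← mulVec_mulVec, hxy, hSy, hDnh, hw, mulVec_sub]
    simp [dotProduct_sub, Pi.single_eq_of_ne, hpq, hpq.symm, ← mul_inv,
      Real.mul_self_sqrt (hdpos _).le]
  have hdet : H.det ≠ 0 := by
    rw [hH, hDnh, det_mul, det_mul, det_diagonal]
    have hprod : ∏ i, (√(d i))⁻¹ ≠ 0 := Finset.prod_ne_zero_iff.2 fun i _ => inv_ne_zero (hsq i)
    exact mul_ne_zero (mul_ne_zero hprod hSinv.ne_zero) hprod
  obtain ⟨hlow, hupp⟩ := hHh.dotProduct_self_bounds hdet x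
  rw [hHx] at hlow hupp
  rw [hform]
  have hinf (i : Fin n) : ⨅ j, (d j)⁻¹ ≤ (d i)⁻¹ := ciInf_le (Set.finite_range _).bddBelow i
  have hsup (i : Fin n) : (d i)⁻¹ ≤ ⨆ j, (d j)⁻¹ :=
    le_ciSup (f := fun j => (d j)⁻¹) (Set.finite_range _).bddAbove i
  have hinf0 : 0 ≤ ⨅ i, (hHh.eigenvalues i)⁻¹ ^ 2 := Real.iInf_nonneg fun _ => sq_nonneg _
  have hsup0 : 0 ≤ ⨆ i, (hHh.eigenvalues i)⁻¹ ^ 2 := Real.iSup_nonneg fun _ => sq_nonneg _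
  constructor
  · refine le_trans ?_ hlow
    rw [mul_comm]
    exact mul_le_mul_of_nonneg_left (by linarith [hinf p, hinf q]) hinf0
  · refine hupp.trans ?_
    rw [mul_comm]
    exact mul_le_mul_of_nonneg_right (by linarith [hsup p, hsup q]) hsup0
end

section
/- Assume S is symmetric positive definite, a > 0, a·wᵀS⁻¹w = 1 (the cut-edge condition), and p ≠ q. Let H = D^{−1/2}·S·D^{−1/2} with eigenvalues η₁,…,η_n. Then (2/a)·min_i η_i⁻¹ ≤ 2·wᵀS⁻¹DS⁻¹DS⁻¹w/(a·wᵀS⁻¹DS⁻¹w) ≤ (2/a)·max_i η_i⁻¹. (This is the bound (2/a_pq)·min{1, 1/(1−λ₁)} ≤ c^F(p,q) ≤ (2/a_pq)·max{1, 1/(1−λ_{n−1})} on the filtered centrality of a cut-edge, where λ_i are the eigenvalues of P = D⁻¹A.) -/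
open Matrix BigOperators

/-- The quadratic form of a Hermitian matrix `H`, and the squared norm of `H z`, diagonalised
simultaneously in coordinates `c` of `z` along the eigenvectors. -/
theorem exists_eigenvector_coordinates {n : Type*} [Fintype n] [DecidableEq n]
    {H : Matrix n n ℝ} (hH : H.IsHermitian) (z : n → ℝ) :
    ∃ c : n → ℝ, z ⬝ᵥ H *ᵥ z = ∑ i, hH.eigenvalues i * c i ^ 2 ∧
      H *ᵥ z ⬝ᵥ H *ᵥ z = ∑ i, hH.eigenvalues i ^ 2 * c i ^ 2 := by
  let U : Matrix n n ℝ := hH.eigenvectorUnitary.1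
  have hspec : H = U * diagonal hH.eigenvalues * Uᵀ := by
    have h := hH.spectral_theorem
    rw [Unitary.conjStarAlgAut_apply] at h
    exact h
  have hUU : Uᵀ * U = 1 := by
    have h := Unitary.coe_star_mul_self hH.eigenvectorUnitary
    exact h
  have hmul : H *ᵥ z = U *ᵥ (diagonal hH.eigenvalues *ᵥ (Uᵀ *ᵥ z)) := by
    conv_lhs => rw [hspec]
    simp only [mulVec_mulVec, Matrix.mul_assoc]
  refine ⟨Uᵀ *ᵥ z, ?_, ?_⟩
  · rw [hmul, dotProduct_mulVec, ← mulVec_transpose]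
    refine Finset.sum_congr rfl fun i _ => ?_
    rw [mulVec_diagonal]
    ring
  · rw [hmul, dotProduct_mulVec, ← mulVec_transpose, mulVec_mulVec, hUU, one_mulVec]
    refine Finset.sum_congr rfl fun i _ => ?_
    rw [mulVec_diagonal]
    ring

/-- `min_i η_i⁻¹ * ‖H z‖² ≤ zᵀ H z` for a Hermitian matrix `H` with eigenvalues `η_i`. -/
theorem iInf_inv_eigenvalues_mul_le {n : Type*} [Fintype n] [DecidableEq n]
    {H : Matrix n n ℝ} (hH : H.IsHermitian) (z : n → ℝ) :
    (⨅ i, (hH.eigenvalues i)⁻¹) * (H *ᵥ z ⬝ᵥ H *ᵥ z) ≤ z ⬝ᵥ H *ᵥ z := by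
  obtain ⟨c, hc₁, hc₂⟩ := exists_eigenvector_coordinates hH z
  rw [hc₁, hc₂, Finset.mul_sum]
  refine Finset.sum_le_sum fun i _ => ?_
  calc _ ≤ (hH.eigenvalues i)⁻¹ * (hH.eigenvalues i ^ 2 * c i ^ 2) := by
        gcongr
        exact ciInf_le (Set.finite_range _).bddBelow i
    _ = hH.eigenvalues i * c i ^ 2 := by
        rcases eq_or_ne (hH.eigenvalues i) 0 with h | h
        · simp [h]
        · field_simp

/-- `zᵀ H z ≤ max_i η_i⁻¹ * ‖H z‖²` for a Hermitian matrix `H` with eigenvalues `η_i`. -/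
theorem le_iSup_inv_eigenvalues_mul {n : Type*} [Fintype n] [DecidableEq n]
    {H : Matrix n n ℝ} (hH : H.IsHermitian) (z : n → ℝ) :
    z ⬝ᵥ H *ᵥ z ≤ (⨆ i, (hH.eigenvalues i)⁻¹) * (H *ᵥ z ⬝ᵥ H *ᵥ z) := by
  obtain ⟨c, hc₁, hc₂⟩ := exists_eigenvector_coordinates hH z
  rw [hc₁, hc₂, Finset.mul_sum]
  refine Finset.sum_le_sum fun i _ => ?_
  calc hH.eigenvalues i * c i ^ 2
      = (hH.eigenvalues i)⁻¹ * (hH.eigenvalues i ^ 2 * c i ^ 2) := by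
        rcases eq_or_ne (hH.eigenvalues i) 0 with h | h
        · simp [h]
        · field_simp
    _ ≤ _ := by
        gcongr
        exact le_ciSup (Set.finite_range fun i => (hH.eigenvalues i)⁻¹).bddAbove i

/-- Bound on the filtered centrality of a cut-edge:
`(2/a)·min_i η_i⁻¹ ≤ c^F(p,q) = 2·wᵀS⁻¹DS⁻¹DS⁻¹w/(a·wᵀS⁻¹DS⁻¹w) ≤ (2/a)·max_i η_i⁻¹`,
where `η_i` are the eigenvalues of `H = D^{−1/2}·S·D^{−1/2}`. -/
theorem stmt_10 {n : ℕ} (hn : 2 ≤ n)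
    (A : Matrix (Fin n) (Fin n) ℝ) (hA : A.IsSymm) (hAnn : ∀ i j, 0 ≤ A i j)
    (d : Fin n → ℝ) (hd : d = A.mulVec (fun _ => 1)) (hdpos : ∀ i, 0 < d i)
    (D L S : Matrix (Fin n) (Fin n) ℝ)
    (hD : D = Matrix.diagonal d) (hL : L = D - A)
    (hS : S = L + (1 / (∑ i, d i)) • Matrix.vecMulVec d d)
    (p q : Fin n) (hpq : p ≠ q)
    (w : Fin n → ℝ) (hw : w = Pi.single p 1 - Pi.single q 1)
    (hSpd : S.PosDef)
    (a : ℝ) (ha : 0 < a) (hcut : a * (w ⬝ᵥ S⁻¹.mulVec w) = 1)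
    (Dneghalf H : Matrix (Fin n) (Fin n) ℝ)
    (hDnh : Dneghalf = Matrix.diagonal (fun i => (Real.sqrt (d i))⁻¹))
    (hH : H = Dneghalf * S * Dneghalf)
    (hHh : H.IsHermitian) :
    (2 / a) * (⨅ i, (hHh.eigenvalues i)⁻¹)
        ≤ 2 * (w ⬝ᵥ (S⁻¹ * D * S⁻¹ * D * S⁻¹).mulVec w)
            / (a * (w ⬝ᵥ (S⁻¹ * D * S⁻¹).mulVec w)) ∧
      2 * (w ⬝ᵥ (S⁻¹ * D * S⁻¹ * D * S⁻¹).mulVec w)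
          / (a * (w ⬝ᵥ (S⁻¹ * D * S⁻¹).mulVec w))
        ≤ (2 / a) * (⨆ i, (hHh.eigenvalues i)⁻¹) := by
  have hST : Sᵀ = S := hSpd.isHermitian
  have hdet : IsUnit S.det := (Matrix.isUnit_iff_isUnit_det S).1 hSpd.isUnit
  have hSinvT : S⁻¹ᵀ = S⁻¹ := by rw [transpose_nonsing_inv, hST]
  have hDT : Dᵀ = D := by rw [hD, diagonal_transpose]
  set u := S⁻¹ *ᵥ w with hu
  set v := S⁻¹ *ᵥ (D *ᵥ u) with hv
  have hSv : S *ᵥ v = D *ᵥ u := by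
    rw [hv, mulVec_mulVec, mul_nonsing_inv _ hdet, one_mulVec]
  have hden : w ⬝ᵥ (S⁻¹ * D * S⁻¹) *ᵥ w = u ⬝ᵥ D *ᵥ u := by
    rw [← mulVec_mulVec, ← mulVec_mulVec, dotProduct_mulVec, ← mulVec_transpose, hSinvT]
  have hnum : w ⬝ᵥ (S⁻¹ * D * S⁻¹ * D * S⁻¹) *ᵥ w = v ⬝ᵥ S *ᵥ v := by
    simp only [← mulVec_mulVec]
    rw [dotProduct_mulVec, ← mulVec_transpose, hSinvT, dotProduct_mulVec, ← mulVec_transpose,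
      hDT, hSv, dotProduct_comm]
  have hu0 : u ≠ 0 := by
    intro h
    rw [h, dotProduct_zero, mul_zero] at hcut
    exact zero_ne_one hcut
  have hpos : 0 < u ⬝ᵥ D *ᵥ u := by
    have hDpd : D.PosDef := by
      rw [hD]
      exact PosDef.diagonal hdpos
    simpa using hDpd.dotProduct_mulVec_pos hu0
  have hsq (i : Fin n) : Real.sqrt (d i) ≠ 0 := (Real.sqrt_pos.2 (hdpos i)).ne'
  set z : Fin n → ℝ := fun i => Real.sqrt (d i) * v i with hz
  have hNz : Dneghalf *ᵥ z = v := by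
    ext i
    rw [hDnh, mulVec_diagonal, hz, inv_mul_cancel_left₀ (hsq i)]
  have hHz : H *ᵥ z = Dneghalf *ᵥ (D *ᵥ u) := by
    rw [hH, ← mulVec_mulVec, ← mulVec_mulVec, hNz, hSv]
  have hzHz : z ⬝ᵥ H *ᵥ z = v ⬝ᵥ S *ᵥ v := by
    have hT : Dneghalfᵀ = Dneghalf := by rw [hDnh, diagonal_transpose]
    rw [hHz, dotProduct_mulVec, ← mulVec_transpose, hT, hNz, hSv]
  have hHzHz : H *ᵥ z ⬝ᵥ H *ᵥ z = u ⬝ᵥ D *ᵥ u := by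
    rw [hHz]
    refine Finset.sum_congr rfl fun i _ => ?_
    rw [hDnh, hD, mulVec_diagonal, mulVec_diagonal]
    have hi := hsq i
    field_simp
    rw [Real.sq_sqrt (hdpos i).le]
    ring
  have hlow := iInf_inv_eigenvalues_mul_le hHh z
  have hupp := le_iSup_inv_eigenvalues_mul hHh z
  rw [hzHz, hHzHz] at hlow hupp
  rw [hnum, hden, mul_div_mul_comm]
  constructor
  · gcongr
    rwa [le_div_iff₀ hpos]
  · gcongr
    rwa [div_le_iff₀ hpos]
end

section
/- Let n ≥ 2 and let A be the adjacency matrix of the unweighted path graph on n vertices: a_{i,i+1} = a_{i+1,i} = 1 for 1 ≤ i ≤ n−1 and all other entries zero. Let d = A·𝟙, D = diag(d), S = D − A + (1/(𝟙ᵀd))·d·dᵀ, and for 1 ≤ q ≤ n−1 let w = e_q − e_{q+1}. Then wᵀS⁻¹DS⁻¹w = (2q−1)(2n−2q−1)/(2(n−1)). (That is, the centrality μ(q,q+1) of edge {q,q+1} in the unit-weight one-path graph equals (2q−1)(2n−2q−1)/(2(n−1)).) -/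
open Matrix BigOperators

/-- The adjacency operator of the path graph sums the values at the two neighbours. -/
lemma sum_path_adj_mul {n : ℕ} (f : ℕ → ℝ) (i : ℕ) :
    ∑ j : Fin n, (if i + 1 = (j : ℕ) ∨ (j : ℕ) + 1 = i then (1 : ℝ) else 0) * f j
      = (if i + 1 < n then f (i + 1) else 0) + (if 1 ≤ i ∧ i ≤ n then f (i - 1) else 0) := by
  rw [Fin.sum_univ_eq_sum_range
    (fun j => (if i + 1 = j ∨ j + 1 = i then (1 : ℝ) else 0) * f j) n]
  have h : ∀ j, (if i + 1 = j ∨ j + 1 = i then (1 : ℝ) else 0) * f j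
      = (if i + 1 = j then f j else 0) + (if 1 ≤ i then (if i - 1 = j then f j else 0) else 0) := by
    intro j
    split_ifs <;> first | omega | simp
  rw [Finset.sum_congr rfl fun j _ => h j, Finset.sum_add_distrib, Finset.sum_ite_eq]
  congr 1
  · simp
  · by_cases hi : 1 ≤ i
    · simp only [hi, if_true, Finset.sum_ite_eq, Finset.mem_range, true_and]
      congr 1
      apply propext
      omega
    · simp [hi]

/-- The number of neighbours of the `i`-th vertex of the path on `n` vertices. -/
noncomputable def pathDegree (n i : ℕ) : ℝ :=
  (if i + 1 < n then 1 else 0) + (if 1 ≤ i then 1 else 0)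

lemma sum_range_pathDegree {n m : ℕ} (hm : 1 ≤ m) (hmn : m < n) :
    ∑ i ∈ Finset.range m, pathDegree n i = 2 * m - 1 := by
  induction m, hm using Nat.le_induction with
  | base => norm_num [pathDegree, hmn]
  | succ k hk ih =>
    rw [Finset.sum_range_succ, ih (by omega), pathDegree, if_pos hmn, if_pos hk]
    push_cast
    ring

lemma sum_range_pathDegree_self {n : ℕ} (hn : 2 ≤ n) :
    ∑ i ∈ Finset.range n, pathDegree n i = 2 * ((n : ℝ) - 1) := by
  obtain ⟨m, rfl⟩ : ∃ m, n = m + 1 := ⟨n - 1, by omega⟩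
  rw [Finset.sum_range_succ, sum_range_pathDegree (by omega) (by omega), pathDegree,
    if_neg (by omega), if_pos (by omega)]
  push_cast
  ring

lemma sum_pathDegree_mul_ite {n q : ℕ} (hq1 : 1 ≤ q) (hqn : q < n) (a b : ℝ) :
    ∑ i : Fin n, pathDegree n i * (if (i : ℕ) < q then a else b)
      = a * (2 * q - 1) + b * (2 * n - 2 * q - 1) := by
  have hsum := sum_range_pathDegree_self (n := n) (by omega)
  have hL := sum_range_pathDegree hq1 hqn
  rw [Fin.sum_univ_eq_sum_range (fun i => pathDegree n i * (if i < q then a else b)) n]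
  rw [← Finset.sum_range_add_sum_Ico _ hqn.le] at hsum ⊢
  rw [Finset.sum_congr rfl (g := fun i => pathDegree n i * a)
      (fun i hi => by rw [if_pos (Finset.mem_range.1 hi)]),
    Finset.sum_congr (s₁ := Finset.Ico q n) rfl (g := fun i => pathDegree n i * b)
      (fun i hi => by rw [if_neg (not_lt.2 (Finset.mem_Ico.1 hi).1)]),
    ← Finset.sum_mul, ← Finset.sum_mul, hL]
  linear_combination b * (hsum - hL)

/-- If the Laplacian `diag(d) - A` has only constants in its kernel, then the matrix obtained by
adding a multiple of `d dᵀ` is invertible. -/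
lemma isUnit_det_laplacian_add_vecMulVec {n : ℕ} (A : Matrix (Fin n) (Fin n) ℝ)
    (hA : A.IsSymm) (d : Fin n → ℝ) (hd : d = A *ᵥ (fun _ => 1)) (hV : ∑ i, d i ≠ 0)
    (hker : ∀ x, (diagonal d - A) *ᵥ x = 0 → ∀ i j, x i = x j) :
    IsUnit (diagonal d - A + (1 / (∑ i, d i)) • vecMulVec d d).det := by
  rw [isUnit_iff_ne_zero]
  intro hdet
  obtain ⟨x, hx0, hx⟩ := exists_mulVec_eq_zero_iff.2 hdet
  have hmul : (diagonal d - A) *ᵥ x + ((1 / (∑ i, d i)) * (d ⬝ᵥ x)) • d = 0 := by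
    rw [← hx, add_mulVec, smul_mulVec, vecMulVec_mulVec]
    ext i
    simp
    ring
  have hone : (fun _ => (1 : ℝ)) ⬝ᵥ ((diagonal d - A) *ᵥ x) = 0 := by
    rw [dotProduct_mulVec, ← mulVec_transpose, transpose_sub, hA.eq, diagonal_transpose,
      sub_mulVec, ← hd]
    have : diagonal d *ᵥ (fun _ => (1 : ℝ)) = d := by ext i; simp [mulVec_diagonal]
    simp [this]
  have hdx : d ⬝ᵥ x = 0 := by
    have h := congrArg (fun v => (fun _ => (1 : ℝ)) ⬝ᵥ v) hmul
    simp only [dotProduct_add, hone, dotProduct_smul, dotProduct_zero, zero_add] at h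
    have h1 : (fun _ => (1 : ℝ)) ⬝ᵥ d = ∑ i, d i := by simp [dotProduct]
    rw [h1, smul_eq_mul] at h
    field_simp at h
    exact h
  rw [hdx, mul_zero, zero_smul, add_zero] at hmul
  have hc := hker x hmul
  apply hx0
  ext i
  have : d ⬝ᵥ x = (∑ j, d j) * x i := by
    rw [dotProduct, Finset.sum_mul]
    exact Finset.sum_congr rfl fun j _ => by rw [hc j i]
  rw [hdx] at this
  simpa [hV] using this.symm

/-- The centrality `μ(q,q+1) = wᵀS⁻¹DS⁻¹w` of edge `{q,q+1}` in the unit-weight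
one-path graph on `n` vertices equals `(2q−1)(2n−2q−1)/(2(n−1))` (vertices `1,…,n`
are represented by `Fin n`, so vertex `q` is `⟨q−1,_⟩`). -/
theorem stmt_11 {n : ℕ} (hn : 2 ≤ n)
    (A : Matrix (Fin n) (Fin n) ℝ)
    (hA : ∀ i j : Fin n, A i j =
      if (i : ℕ) + 1 = (j : ℕ) ∨ (j : ℕ) + 1 = (i : ℕ) then 1 else 0)
    (d : Fin n → ℝ) (hd : d = A.mulVec (fun _ => 1))
    (D S : Matrix (Fin n) (Fin n) ℝ)
    (hD : D = Matrix.diagonal d)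
    (hS : S = D - A + (1 / (∑ i, d i)) • Matrix.vecMulVec d d)
    (q : ℕ) (hq1 : 1 ≤ q) (hq2 : q ≤ n - 1)
    (w : Fin n → ℝ)
    (hw : w = Pi.single (⟨q - 1, by omega⟩ : Fin n) 1
            - Pi.single (⟨q, by omega⟩ : Fin n) 1) :
    w ⬝ᵥ (S⁻¹ * D * S⁻¹).mulVec w
      = (2 * (q : ℝ) - 1) * (2 * (n : ℝ) - 2 * (q : ℝ) - 1) / (2 * ((n : ℝ) - 1)) := by
  obtain ⟨m, rfl⟩ : ∃ m, n = m + 1 := ⟨n - 1, by omega⟩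
  have hqn : q < m + 1 := by omega
  have hAmul : ∀ (f : ℕ → ℝ) (i : Fin (m + 1)), (A *ᵥ fun j => f j) i
      = (if (i : ℕ) + 1 < m + 1 then f (i + 1) else 0)
        + (if 1 ≤ (i : ℕ) then f (i - 1) else 0) := by
    intro f i
    have := sum_path_adj_mul (n := m + 1) f i
    simpa [mulVec, dotProduct, hA, i.2.le] using this
  have hdeg : ∀ i, d i = pathDegree (m + 1) i := by
    intro i
    rw [hd]
    exact hAmul (fun _ => 1) i
  have hsymm : A.IsSymm := by
    ext i j
    simp only [transpose_apply, hA, or_comm]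
  have hV : ∑ i, d i = 2 * (((m + 1 : ℕ) : ℝ) - 1) := by
    rw [← sum_range_pathDegree_self hn, ← Fin.sum_univ_eq_sum_range]
    exact Finset.sum_congr rfl fun i _ => hdeg i
  have hm : (m : ℝ) ≠ 0 := by
    norm_cast
    omega
  have hV0 : ∑ i, d i ≠ 0 := by
    rw [hV]
    push_cast
    simpa using hm
  have hker : ∀ x, (diagonal d - A) *ᵥ x = 0 → ∀ i j, x i = x j := by
    classical
    have hAG : A = (SimpleGraph.pathGraph (m + 1)).adjMatrix ℝ := by
      ext i j
      simp [hA, SimpleGraph.adjMatrix_apply, SimpleGraph.pathGraph_adj]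
    have hL : diagonal d - A = (SimpleGraph.pathGraph (m + 1)).lapMatrix ℝ := by
      rw [SimpleGraph.lapMatrix, SimpleGraph.degMatrix, ← hAG]
      congr 2
      ext i
      rw [hd, hAG]
      simp [SimpleGraph.adjMatrix_mulVec_apply]
    intro x hx i j
    rw [hL] at hx
    exact (SimpleGraph.lapMatrix_mulVec_eq_zero_iff_forall_reachable _).1 hx i j
      ((SimpleGraph.pathGraph_connected m).preconnected i j)
  have hunit : IsUnit S.det := by
    rw [hS, hD]
    exact isUnit_det_laplacian_add_vecMulVec A hsymm d hd hV0 hker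
  have hSsymm : Sᵀ = S := by
    rw [hS, hD]
    simp [transpose_sub, hsymm.eq, transpose_vecMulVec]
  set a : ℝ := (2 * ((m + 1 : ℕ) : ℝ) - 2 * q - 1) / (2 * m) with ha
  set b : ℝ := -(2 * (q : ℝ) - 1) / (2 * m) with hb
  have hab : a - b = 1 := by
    rw [ha, hb]
    push_cast
    field_simp
    ring
  set x : Fin (m + 1) → ℝ := fun i => if (i : ℕ) < q then a else b with hx
  have hdx : d ⬝ᵥ x = 0 := by
    have := sum_pathDegree_mul_ite hq1 hqn a b
    simp only [dotProduct, hdeg, hx]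
    rw [this, ha, hb]
    ring
  have hSx : S *ᵥ x = w := by
    rw [hS, hD, add_mulVec, smul_mulVec, vecMulVec_mulVec, hdx, sub_mulVec]
    ext i
    have h := hAmul (fun i => if i < q then a else b) i
    have hi := i.2
    simp only [Pi.add_apply, Pi.sub_apply, mulVec_diagonal, hdeg, hw, Pi.single_apply,
      Fin.ext_iff, pathDegree, hx, h]
    simp only [MulOpposite.op_zero, zero_smul, smul_zero, Pi.zero_apply, add_zero]
    split_ifs <;> first | omega | linarith
  have hinv : S⁻¹ *ᵥ w = x := by
    rw [← hSx, mulVec_mulVec, nonsing_inv_mul _ hunit, one_mulVec]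
  have hinv' : w ᵥ* S⁻¹ = x := by
    rw [← mulVec_transpose, transpose_nonsing_inv, hSsymm, hinv]
  rw [← mulVec_mulVec, hinv, ← mulVec_mulVec, dotProduct_mulVec, hinv', hD]
  have hxx : x ⬝ᵥ diagonal d *ᵥ x
      = ∑ i : Fin (m + 1), pathDegree (m + 1) i * (if (i : ℕ) < q then a ^ 2 else b ^ 2) := by
    refine Finset.sum_congr rfl fun i _ => ?_
    rw [mulVec_diagonal, hdeg]
    simp only [hx]
    split_ifs <;> ring
  rw [hxx, sum_pathDegree_mul_ite hq1 hqn, ha, hb]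
  push_cast
  rw [add_sub_cancel_right]
  field_simp
  ring
end

section
/- Let x ∈ ℝⁿ satisfy S·x = w, where w = e_p − e_q with p ≠ q. Then dᵀx = 0, and consequently L·x = w. (This is the key fact underlying the algorithm for computing the centrality measures via the Cholesky factorization of the Laplacian: the solution of the rank-one-corrected system automatically lies in the hyperplane dᵀx = 0 and solves the singular Laplacian system.) -/
open Matrix BigOperators

/-- If `S·x = w` with `w = e_p − e_q`, then `dᵀx = 0` and consequently `L·x = w`:
the solution of the rank-one-corrected system lies in the hyperplane `dᵀx = 0` and
solves the singular Laplacian system. -/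
theorem stmt_15 {n : ℕ} (hn : 2 ≤ n)
    (A : Matrix (Fin n) (Fin n) ℝ) (hA : A.IsSymm) (hAnn : ∀ i j, 0 ≤ A i j)
    (d : Fin n → ℝ) (hd : d = A.mulVec (fun _ => 1)) (hdpos : ∀ i, 0 < d i)
    (D L S : Matrix (Fin n) (Fin n) ℝ)
    (hD : D = Matrix.diagonal d) (hL : L = D - A)
    (hS : S = L + (1 / (∑ i, d i)) • Matrix.vecMulVec d d)
    (p q : Fin n) (hpq : p ≠ q)
    (w : Fin n → ℝ) (hw : w = Pi.single p 1 - Pi.single q 1)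
    (x : Fin n → ℝ) (hx : S.mulVec x = w) :
    d ⬝ᵥ x = 0 ∧ L.mulVec x = w := by
  have hsum : ∑ i, d i ≠ 0 := by
    have : Nonempty (Fin n) := ⟨p⟩
    exact (Finset.sum_pos (fun i _ => hdpos i) Finset.univ_nonempty).ne'
  have hS_apply : S *ᵥ x = L *ᵥ x + ((1 / ∑ i, d i) * (d ⬝ᵥ x)) • d := by
    rw [hS, add_mulVec, smul_mulVec, vecMulVec_mulVec, op_smul_eq_smul, smul_smul]
  have hL_one : (fun _ => 1) ᵥ* L = 0 := by
    rw [hL, hD, vecMul_sub, ← mulVec_transpose A, hA.eq, ← hd]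
    ext i
    simp [vecMul_diagonal]
  have hone : (fun _ => (1 : ℝ)) ⬝ᵥ d = ∑ i, d i := by simp [dotProduct]
  have hw_one : (fun _ => (1 : ℝ)) ⬝ᵥ w = 0 := by
    rw [hw, dotProduct_sub, dotProduct_single, dotProduct_single, sub_self]
  have hdx : d ⬝ᵥ x = 0 := by
    rw [← hx, hS_apply, dotProduct_add, dotProduct_mulVec, hL_one, zero_dotProduct,
      zero_add, dotProduct_smul, hone, smul_eq_mul] at hw_one
    field_simp at hw_one
    exact hw_one
  refine ⟨hdx, ?_⟩
  rw [← hx, hS_apply, hdx, mul_zero, zero_smul, add_zero]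
end

section
/- With P = D⁻¹A, the identity I − P + (1/(𝟙ᵀd))·𝟙·dᵀ = D⁻¹·S holds. Moreover, if S is invertible then I − P + (1/(𝟙ᵀd))·𝟙·dᵀ is invertible and trace((I − P + (1/(𝟙ᵀd))·𝟙·dᵀ)⁻¹) = trace(S⁻¹·D). (Hence Kemeny's constant κ(G) = trace((I − P + (1/(𝟙ᵀd))·𝟙·dᵀ)⁻¹) − 1 equals trace(S⁻¹D) − 1.) -/
open Matrix BigOperators

/-- With `P = D⁻¹A`, one has `I − P + (1/(𝟙ᵀd))·𝟙·dᵀ = D⁻¹·S`; if `S` is invertible,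
this matrix is invertible and `trace((I − P + (1/(𝟙ᵀd))·𝟙·dᵀ)⁻¹) = trace(S⁻¹D)`.
Hence Kemeny's constant `κ(G)` equals `trace(S⁻¹D) − 1`. -/
theorem stmt_16 {n : ℕ} (hn : 2 ≤ n)
    (A : Matrix (Fin n) (Fin n) ℝ) (hA : A.IsSymm) (hAnn : ∀ i j, 0 ≤ A i j)
    (d : Fin n → ℝ) (hd : d = A.mulVec (fun _ => 1)) (hdpos : ∀ i, 0 < d i)
    (D L S : Matrix (Fin n) (Fin n) ℝ)
    (hD : D = Matrix.diagonal d) (hL : L = D - A)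
    (hS : S = L + (1 / (∑ i, d i)) • Matrix.vecMulVec d d)
    (P : Matrix (Fin n) (Fin n) ℝ) (hP : P = D⁻¹ * A) :
    1 - P + (1 / (∑ i, d i)) • Matrix.vecMulVec (fun _ => 1) d = D⁻¹ * S ∧
      (IsUnit S.det →
        IsUnit (1 - P + (1 / (∑ i, d i)) • Matrix.vecMulVec (fun _ => 1) d).det ∧
          (1 - P + (1 / (∑ i, d i)) • Matrix.vecMulVec (fun _ => 1) d)⁻¹.trace
            = (S⁻¹ * D).trace) := by
  have hDdet : IsUnit D.det := by
    rw [hD, Matrix.det_diagonal]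
    exact (Finset.prod_pos fun i _ => hdpos i).ne'.isUnit
  have hDmul : D * Matrix.vecMulVec (fun _ => 1) d = Matrix.vecMulVec d d := by
    ext i j
    simp [hD, Matrix.diagonal_mul, Matrix.vecMulVec_apply]
  have hfactor : 1 - P + (1 / (∑ i, d i)) • Matrix.vecMulVec (fun _ => 1) d = D⁻¹ * S := by
    rw [hS, hL, hP, ← hDmul, Matrix.mul_add, Matrix.mul_sub, Matrix.mul_smul,
      Matrix.nonsing_inv_mul D hDdet, Matrix.nonsing_inv_mul_cancel_left D _ hDdet]
  refine ⟨hfactor, fun hSdet => ?_⟩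
  rw [hfactor]
  constructor
  · rw [Matrix.det_mul]
    exact (Matrix.isUnit_nonsing_inv_det D hDdet).mul hSdet
  · rw [Matrix.mul_inv_rev, Matrix.nonsing_inv_nonsing_inv D hDdet]
end

section
/- Let a ∈ ℝ. The real function t ↦ trace((S − t·a·w·wᵀ)⁻¹·D) has derivative at t = 0 equal to a·β, where β = wᵀS⁻¹DS⁻¹w. (That is, the directional derivative μ(p,q) of Kemeny's constant along the direction a_pq·D⁻¹·w·wᵀ exists and equals a_pq·β(p,q); likewise the unweighted directional derivative μ̄(p,q) equals β(p,q).) -/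
open Matrix BigOperators

/-- The derivative at `0` of a continuous linear functional of the inverse along a line through an
invertible element of a Banach algebra. -/
theorem hasDerivAt_clm_ringInverse_sub_smul {R : Type*} [NormedRing R] [NormedAlgebra ℝ R]
    [CompleteSpace R] (φ : R →L[ℝ] ℝ) (u : Rˣ) (W : R) (a : ℝ) :
    HasDerivAt (fun t : ℝ => φ (Ring.inverse ((u : R) - (t * a) • W)))
      (a * φ (↑u⁻¹ * W * ↑u⁻¹)) 0 := by
  have hline : HasDerivAt (fun t : ℝ => (u : R) - (t * a) • W) (-(a • W)) 0 := by
    simpa using (((hasDerivAt_id (0 : ℝ)).mul_const a).smul_const W).const_sub (u : R)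
  have hinv := (hasFDerivAt_ringInverse (𝕜 := ℝ) u).comp_hasDerivAt_of_eq (0 : ℝ) hline (by simp)
  simpa [Function.comp_def] using φ.hasFDerivAt.comp_hasDerivAt (0 : ℝ) hinv

section

attribute [local instance] Matrix.linftyOpNormedRing Matrix.linftyOpNormedAlgebra

/-- The derivative at `0` of a weighted trace of the inverse along a line through an invertible
matrix. -/
theorem hasDerivAt_trace_inv_sub_smul_mul {m : Type*} [Fintype m] [DecidableEq m]
    (S W D : Matrix m m ℝ) (hS : IsUnit S) (a : ℝ) :
    HasDerivAt (fun t : ℝ => ((S - (t * a) • W)⁻¹ * D).trace)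
      (a * (S⁻¹ * W * S⁻¹ * D).trace) 0 := by
  obtain ⟨u, rfl⟩ := hS
  have : CompleteSpace (Matrix m m ℝ) := FiniteDimensional.complete ℝ _
  let φ : Matrix m m ℝ →L[ℝ] ℝ :=
    (Matrix.traceLinearMap m ℝ ℝ ∘ₗ LinearMap.mulRight ℝ D).toContinuousLinearMap
  have h := hasDerivAt_clm_ringInverse_sub_smul φ u W a
  simp only [← nonsing_inv_eq_ringInverse, Matrix.coe_units_inv] at h
  exact h

end

/-- The directional derivative of Kemeny's constant: the function
`t ↦ trace((S − t·a·w·wᵀ)⁻¹·D)` has derivative `a·β` at `t = 0`, where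
`β = wᵀS⁻¹DS⁻¹w`; that is, `μ(p,q) = a_pq·β(p,q)` and `μ̄(p,q) = β(p,q)`. -/
theorem stmt_17 {n : ℕ} (hn : 2 ≤ n)
    (A : Matrix (Fin n) (Fin n) ℝ) (hA : A.IsSymm) (hAnn : ∀ i j, 0 ≤ A i j)
    (d : Fin n → ℝ) (hd : d = A.mulVec (fun _ => 1)) (hdpos : ∀ i, 0 < d i)
    (D L S : Matrix (Fin n) (Fin n) ℝ)
    (hD : D = Matrix.diagonal d) (hL : L = D - A)
    (hS : S = L + (1 / (∑ i, d i)) • Matrix.vecMulVec d d)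
    (p q : Fin n) (hpq : p ≠ q)
    (w : Fin n → ℝ) (hw : w = Pi.single p 1 - Pi.single q 1)
    (hSinv : IsUnit S.det)
    (a : ℝ) :
    HasDerivAt (fun t : ℝ => ((S - (t * a) • Matrix.vecMulVec w w)⁻¹ * D).trace)
      (a * (w ⬝ᵥ (S⁻¹ * D * S⁻¹).mulVec w)) 0 := by
  have htrace : (S⁻¹ * vecMulVec w w * S⁻¹ * D).trace = w ⬝ᵥ (S⁻¹ * D * S⁻¹).mulVec w := by
    rw [Matrix.mul_assoc, Matrix.mul_assoc, Matrix.trace_mul_comm, Matrix.mul_assoc,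
      vecMulVec_mul, trace_vecMulVec, dotProduct_mulVec, dotProduct_comm]
  rw [← htrace]
  exact hasDerivAt_trace_inv_sub_smul_mul S _ D ((isUnit_iff_isUnit_det S).2 hSinv) a
end
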